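/- Under conditions (C), (D1) and (D2), there exist β̂₁ ∈ ℝ, σ̂₁ ≥ 0 and a σ-finite measure μ on (0, ∞) with ∫₀^∞ (u ∧ u²) μ(du) < ∞ such that as n → ∞: (i) n² ∫_{[−1,∞)} (χ(u) − u) μ_n(du) → β̂₁; (ii) n² ∫_{[−1,∞)} χ²(u) μ_n(du) → 2σ̂₁ + ∫₀^∞ χ²(u) μ(du); (iii) n² ∫_{[−1,∞)} f(u) μ_n(du) → ∫₀^∞ f(u) μ(du) for every bounded continuous f : ℝ → ℝ with f(x) = o(x²) as x → 0; and moreover (n²/c_n) ∫_{[−1,∞)} χ(u) μ_n(du) → aγ₀. -/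

import Mathlib

open MeasureTheory Filter Topology

/-- The probability generating function of an `ℕ`-valued distribution `p`. -/
noncomputable def pgf (p : ℕ → ℝ) (s : ℝ) : ℝ := ∑' i, p i * s ^ i

/-- The mean `g'(1) = ∑ i * p i` of an `ℕ`-valued distribution `p`. -/
noncomputable def pgfMean (p : ℕ → ℝ) : ℝ := ∑' i : ℕ, (i : ℝ) * p i

/-- `G_n(λ) = n² [(1 − m_n λ/c_n) − g_n(1 − λ/c_n)]`. -/
noncomputable def Gseq (p : ℕ → ℕ → ℝ) (c : ℕ → ℝ) (n : ℕ) (l : ℝ) : ℝ :=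
  (n : ℝ) ^ 2 * ((1 - pgfMean (p n) * l / c n) - pgf (p n) (1 - l / c n))

/-- `χ(x) = (1 ∧ x) ∨ (−1)`. -/
noncomputable def chi (x : ℝ) : ℝ := max (min 1 x) (-1)

/-- `μ_n = ∑ᵢ p_n(i) δ_{(i−1)/c_n}`, the law of `(ξ−1)/c_n` for `ξ` with distribution `p_n`. -/
noncomputable def lawShiftDiv (p : ℕ → ℝ) (c : ℝ) : Measure ℝ :=
  Measure.sum fun i : ℕ => ENNReal.ofReal (p i) • Measure.dirac (((i : ℝ) - 1) / c)

open scoped BoundedContinuousFunction ENNReal NNReal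

section WeakConvergence

variable {E : Type*} [MeasurableSpace E] [TopologicalSpace E] [PolishSpace E] [BorelSpace E]

/-- The powers of an injective bounded continuous function determine a finite measure. -/
theorem MeasureTheory.Measure.ext_of_integral_pow_eq {P P' : Measure E} [IsFiniteMeasure P]
    [IsFiniteMeasure P'] (φ : E →ᵇ ℝ) (hφ : Function.Injective φ)
    (h : ∀ k : ℕ, ∫ x, φ x ^ k ∂P = ∫ x, φ x ^ k ∂P') : P = P' := by
  let A : StarSubalgebra ℝ (E →ᵇ ℝ) :=
    { Algebra.adjoin ℝ {φ} with
      star_mem' := fun {a} ha => by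
        have : star a = a := by ext x; simp
        rw [this]; exact ha }
  refine ext_of_forall_mem_subalgebra_integral_eq_of_polish (𝕜 := ℝ) (A := A) ?_ ?_
  · intro x y hxy
    refine ⟨φ, ⟨φ.toContinuousMap, ⟨φ, Algebra.subset_adjoin rfl, rfl⟩, rfl⟩, fun e => hxy (hφ e)⟩
  · intro g hg
    replace hg : g ∈ Algebra.adjoin ℝ {φ} := hg
    rw [Algebra.adjoin_singleton_eq_range_aeval] at hg
    obtain ⟨q, rfl⟩ := hg
    have key : ∀ x, (Polynomial.aeval φ q) x
        = ∑ i ∈ Finset.range (q.natDegree + 1), q.coeff i * φ x ^ i := by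
      intro x
      simp [Polynomial.aeval_eq_sum_range]
    have hint : ∀ (Q : Measure E) [IsFiniteMeasure Q] (i : ℕ),
        Integrable (fun x => q.coeff i * φ x ^ i) Q := fun Q _ i =>
      ((φ ^ i).integrable Q).const_mul _
    simp only [AlgHom.toRingHom_eq_coe, RingHom.coe_coe, key]
    rw [integral_finsetSum _ fun i _ => hint P i, integral_finsetSum _ fun i _ => hint P' i]
    simp only [integral_const_mul, h]

/-- A tight sequence of finite measures of bounded mass converges weakly as soon as its integrals
against all the powers of some injective bounded continuous function converge. -/
theorem MeasureTheory.FiniteMeasure.exists_tendsto_of_tendsto_integral_pow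
    {ν : ℕ → FiniteMeasure E} {u : ℕ → ℝ≥0} {K : ℕ → Set E} (C : ℝ≥0)
    (hu : Tendsto u atTop (𝓝 0)) (hK : ∀ n, IsCompact (K n)) (hKm : Monotone K)
    (hν : ∀ᶠ n in atTop, (ν n).mass ≤ C ∧ ∀ m, ν n (K m)ᶜ ≤ u m)
    (φ : E →ᵇ ℝ) (hφ : Function.Injective φ)
    (h : ∀ k : ℕ, ∃ L, Tendsto (fun n => ∫ x, φ x ^ k ∂(ν n : Measure E)) atTop (𝓝 L)) :
    ∃ ν₀, Tendsto ν atTop (𝓝 ν₀) := by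
  choose L hL using h
  have hc := isCompact_setOfPred_finiteMeasure_mass_le_compl_isCompact_le C hu hK (.inr hKm)
  have hcl : ∀ ρ : FiniteMeasure E, MapClusterPt ρ atTop ν →
      ∀ k : ℕ, ∫ x, φ x ^ k ∂(ρ : Measure E) = L k := by
    intro ρ hρ k
    have hcont : Continuous fun ρ : FiniteMeasure E => ∫ x, φ x ^ k ∂(ρ : Measure E) :=
      continuous_iff_continuousAt.2 fun ρ =>
        FiniteMeasure.tendsto_iff_forall_integral_tendsto.1 tendsto_id (φ ^ k)
    have := hρ.continuousAt_comp hcont.continuousAt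
    exact eq_of_nhds_neBot (ClusterPt.mono this (hL k))
  obtain ⟨ν₀, -, hν₀⟩ := hc.exists_mapClusterPt (f := atTop) (u := ν)
    (le_principal_iff.2 hν)
  refine ⟨ν₀, hc.tendsto_nhds_of_unique_mapClusterPt hν fun ρ _ hρ => ?_⟩
  apply FiniteMeasure.toMeasure_injective
  exact Measure.ext_of_integral_pow_eq φ hφ fun k => (hcl ρ hρ k).trans (hcl ν₀ hν₀ k).symm

end WeakConvergence

section Law

variable {p : ℕ → ℝ} {c : ℝ}

theorem hasSum_integral_lawShiftDiv (hp0 : ∀ i, 0 ≤ p i) {f : ℝ → ℝ}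
    (hf : Summable fun i : ℕ => p i * |f (((i : ℝ) - 1) / c)|) :
    Integrable f (lawShiftDiv p c) ∧
      HasSum (fun i : ℕ => p i * f (((i : ℝ) - 1) / c)) (∫ u, f u ∂(lawShiftDiv p c)) := by
  have hf' : Summable fun i : ℕ =>
      (ENNReal.ofReal (p i)).toReal * ‖f (((i : ℝ) - 1) / c)‖ := by
    simpa only [ENNReal.toReal_ofReal (hp0 _), Real.norm_eq_abs] using hf
  refine ⟨integrable_sum_dirac (by simp) hf', ?_⟩
  have h := hasSum_integral_sum_dirac (by simp) hf'
  simp only [ENNReal.toReal_ofReal (hp0 _), smul_eq_mul] at h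
  exact h

theorem summable_of_tsum_eq_one (hp1 : ∑' i, p i = 1) : Summable p := by
  by_contra h
  simp [tsum_eq_zero_of_not_summable h] at hp1

theorem isProbabilityMeasure_lawShiftDiv (hp0 : ∀ i, 0 ≤ p i) (hp1 : ∑' i, p i = 1) :
    IsProbabilityMeasure (lawShiftDiv p c) := by
  constructor
  simp [lawShiftDiv, Measure.sum_apply, ← ENNReal.ofReal_tsum_of_nonneg hp0
    (summable_of_tsum_eq_one hp1), hp1]

theorem ae_lawShiftDiv_ge (hc : 0 < c) : ∀ᵐ u ∂(lawShiftDiv p c), -(1 / c) ≤ u := by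
  rw [lawShiftDiv, Measure.ae_sum_iff]
  intro i
  apply Measure.ae_smul_measure
  rw [ae_dirac_eq]
  change -(1 / c) ≤ ((i : ℝ) - 1) / c
  rw [← neg_div]
  gcongr
  linarith [(Nat.cast_nonneg i : (0 : ℝ) ≤ i)]

theorem integral_id_lawShiftDiv (hp0 : ∀ i, 0 ≤ p i) (hp1 : ∑' i, p i = 1)
    (hpm : Summable fun i : ℕ => (i : ℝ) * p i) :
    Integrable (fun u => u) (lawShiftDiv p c) ∧
      ∫ u, u ∂(lawShiftDiv p c) = (pgfMean p - 1) / c := by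
  have hp := summable_of_tsum_eq_one hp1
  have hs : Summable fun i : ℕ => p i * |((i : ℝ) - 1) / c| := by
    refine Summable.of_nonneg_of_le (fun i => mul_nonneg (hp0 i) (abs_nonneg _)) (fun i => ?_)
      ((hpm.add hp).mul_right |c|⁻¹)
    rw [abs_div, div_eq_mul_inv, ← mul_assoc]
    gcongr
    have : |(i : ℝ) - 1| ≤ i + 1 := by
      rw [abs_le]; constructor <;> linarith [(Nat.cast_nonneg i : (0 : ℝ) ≤ i)]
    nlinarith [hp0 i]
  obtain ⟨h1, h2⟩ := hasSum_integral_lawShiftDiv (f := fun u => u) hp0 hs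
  refine ⟨h1, h2.unique ?_⟩
  have h3 := (hpm.hasSum.sub hp.hasSum).div_const c
  rw [hp1] at h3
  have e : (fun i : ℕ => p i * (((i : ℝ) - 1) / c)) = fun i : ℕ => (i * p i - p i) / c := by
    ext i; ring
  rw [e]
  exact h3

theorem integral_exp_lawShiftDiv (hp0 : ∀ i, 0 ≤ p i) (hp1 : ∑' i, p i = 1) (hc : 0 < c)
    {θ : ℝ} (hθ : 0 ≤ θ) :
    Integrable (fun u => Real.exp (-(θ * u))) (lawShiftDiv p c) ∧
      ∫ u, Real.exp (-(θ * u)) ∂(lawShiftDiv p c)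
        = Real.exp (θ / c) * pgf p (Real.exp (-(θ / c))) := by
  have hp := summable_of_tsum_eq_one hp1
  have he : ∀ i : ℕ, Real.exp (-(θ * (((i : ℝ) - 1) / c)))
      = Real.exp (θ / c) * Real.exp (-(θ / c)) ^ i := by
    intro i
    rw [← Real.exp_nat_mul, ← Real.exp_add]
    congr 1
    field_simp
    ring
  have hs0 : Summable fun i : ℕ => p i * Real.exp (-(θ / c)) ^ i := by
    refine Summable.of_nonneg_of_le (fun i => mul_nonneg (hp0 i) (by positivity)) (fun i => ?_) hp
    refine mul_le_of_le_one_right (hp0 i) (pow_le_one₀ (Real.exp_pos _).le ?_)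
    exact Real.exp_le_one_iff.2 (neg_nonpos.2 (by positivity))
  have hs : Summable fun i : ℕ => p i * |Real.exp (-(θ * (((i : ℝ) - 1) / c)))| := by
    refine (hs0.mul_left (Real.exp (θ / c))).congr fun i => ?_
    rw [abs_of_pos (Real.exp_pos _), he]
    ring
  obtain ⟨h1, h2⟩ := hasSum_integral_lawShiftDiv (f := fun u => Real.exp (-(θ * u))) hp0 hs
  refine ⟨h1, h2.unique ?_⟩
  have e : (fun i : ℕ => p i * Real.exp (-(θ * (((i : ℝ) - 1) / c))))
      = fun i => Real.exp (θ / c) * (p i * Real.exp (-(θ / c)) ^ i) := by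
    ext i; rw [he]; ring
  rw [e]
  exact hs0.hasSum.mul_left (Real.exp (θ / c))

/-- The compensated exponential moment of the rescaled law in terms of `Gseq`. -/
theorem sq_mul_integral_exp_sub_one_add (p : ℕ → ℕ → ℝ) (c : ℕ → ℝ) (n : ℕ)
    (hp0 : ∀ i, 0 ≤ p n i) (hp1 : ∑' i, p n i = 1)
    (hpm : Summable fun i : ℕ => (i : ℝ) * p n i) (hc : 0 < c n) {θ : ℝ} (hθ : 0 ≤ θ) :
    (n : ℝ) ^ 2 * ∫ u, (Real.exp (-(θ * u)) - 1 + θ * u) ∂(lawShiftDiv (p n) (c n))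
      = -(Real.exp (θ / c n) * Gseq p c n (c n * (1 - Real.exp (-(θ / c n)))))
        - (n * (pgfMean (p n) - 1)) * ((n / c n ^ 2)
          * (c n ^ 2 * (Real.exp (θ / c n) - 1 - θ / c n))) := by
  have := isProbabilityMeasure_lawShiftDiv (c := c n) hp0 hp1
  obtain ⟨hi, hi'⟩ := integral_id_lawShiftDiv (c := c n) hp0 hp1 hpm
  obtain ⟨he, he'⟩ := integral_exp_lawShiftDiv hp0 hp1 hc hθ
  have hsplit : ∫ u, (Real.exp (-(θ * u)) - 1 + θ * u) ∂(lawShiftDiv (p n) (c n))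
      = ∫ u, Real.exp (-(θ * u)) ∂(lawShiftDiv (p n) (c n)) - 1
        + θ * ∫ u, u ∂(lawShiftDiv (p n) (c n)) := by
    have hsub : Integrable (fun u => Real.exp (-(θ * u)) - 1) (lawShiftDiv (p n) (c n)) :=
      he.sub (integrable_const _)
    rw [← integral_const_mul, integral_add hsub (hi.const_mul θ),
      integral_sub he (integrable_const _)]
    simp
  rw [hsplit, hi', he', Gseq]
  have h1 : 1 - c n * (1 - Real.exp (-(θ / c n))) / c n = Real.exp (-(θ / c n)) := by
    field_simp; ring
  rw [h1]
  have h2 : Real.exp (-(θ / c n)) = (Real.exp (θ / c n))⁻¹ := Real.exp_neg _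
  generalize pgf (p n) (Real.exp (-(θ / c n))) = g
  rw [h2]
  have h3 := Real.exp_pos (θ / c n)
  generalize Real.exp (θ / c n) = e at *
  field_simp
  ring

end Law

section Exponential

theorem tendsto_exp_sub_one_sub_div_sq :
    Tendsto (fun t : ℝ => (Real.exp t - 1 - t) / t ^ 2) (𝓝[≠] 0) (𝓝 (1 / 2)) := by
  have h := (Real.exp_sub_sum_range_succ_isLittleO_pow 2).tendsto_div_nhds_zero.mono_left
    (nhdsWithin_le_nhds (s := {0}ᶜ))
  have h2 := h.add_const (1 / 2)
  rw [zero_add] at h2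
  refine h2.congr' ?_
  filter_upwards [self_mem_nhdsWithin] with t ht
  have ht : t ≠ 0 := ht
  simp [Finset.sum_range_succ]
  field_simp
  ring

theorem tendsto_one_sub_exp_neg_div :
    Tendsto (fun t : ℝ => (1 - Real.exp (-t)) / t) (𝓝[≠] 0) (𝓝 1) := by
  have h := (((hasDerivAt_id (0 : ℝ)).neg.exp.const_sub 1)).tendsto_slope_zero
  simp only [zero_add, smul_eq_mul] at h
  norm_num at h
  refine h.congr fun t => ?_
  rw [div_eq_inv_mul]

theorem tendsto_exp_neg_sub_one_add_div_sq :
    Tendsto (fun t : ℝ => (Real.exp (-t) - 1 + t) / t ^ 2) (𝓝[≠] 0) (𝓝 (1 / 2)) := by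
  have hneg : Tendsto (fun t : ℝ => -t) (𝓝[≠] 0) (𝓝[≠] 0) := by
    refine tendsto_nhdsWithin_iff.2 ⟨?_, ?_⟩
    · exact (continuous_neg.tendsto' 0 0 neg_zero).mono_left nhdsWithin_le_nhds
    · filter_upwards [self_mem_nhdsWithin] with t ht using neg_ne_zero.2 ht
  refine (tendsto_exp_sub_one_sub_div_sq.comp hneg).congr fun t => ?_
  simp

end Exponential

section Limits

variable {c : ℕ → ℝ}

theorem tendsto_atTop_of_tendsto_div_sq (hcpos : ∀ n, 0 < c n) {γ₀ : ℝ}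
    (hC2 : Tendsto (fun n : ℕ => (n : ℝ) / c n ^ 2) atTop (𝓝 γ₀)) : Tendsto c atTop atTop := by
  have h1 : Tendsto (fun n : ℕ => (n : ℝ) / (|γ₀| + 1)) atTop atTop :=
    tendsto_natCast_atTop_atTop.atTop_div_const (by positivity)
  have h2 : Tendsto (fun n => c n ^ 2) atTop atTop := by
    refine tendsto_atTop_mono' atTop ?_ h1
    filter_upwards [hC2.eventually_lt_const
      (show γ₀ < |γ₀| + 1 by linarith [le_abs_self γ₀])] with n hn
    have := hcpos n
    rw [div_lt_iff₀ (by positivity)] at hn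
    rw [div_le_iff₀ (by positivity)]
    linarith
  refine (Real.tendsto_sqrt_atTop.comp h2).congr fun n => ?_
  simp [Real.sqrt_sq (hcpos n).le]

theorem exists_tendsto_sq_mul_integral_exp (p : ℕ → ℕ → ℝ)
    (hp0 : ∀ n i, 0 ≤ p n i) (hp1 : ∀ n, ∑' i, p n i = 1)
    (hpm : ∀ n, Summable fun i : ℕ => (i : ℝ) * p n i) (hcpos : ∀ n, 0 < c n)
    {γ₀ a : ℝ} (hC2 : Tendsto (fun n : ℕ => (n : ℝ) / c n ^ 2) atTop (𝓝 γ₀))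
    (hD1 : Tendsto (fun n : ℕ => (n : ℝ) * (pgfMean (p n) - 1)) atTop (𝓝 a))
    {G : ℝ → ℝ}
    (hGlip : ∀ M > (0 : ℝ), ∃ K : ℝ, ∀ (n : ℕ) (l l' : ℝ),
      l ∈ Set.Icc 0 M → l' ∈ Set.Icc 0 M → l ≤ c n → l' ≤ c n →
      |Gseq p c n l - Gseq p c n l'| ≤ K * |l - l'|)
    (hGlim : ∀ l : ℝ, 0 ≤ l → Tendsto (fun n => Gseq p c n l) atTop (𝓝 (G l)))
    {θ : ℝ} (hθ : 0 ≤ θ) :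
    ∃ L, Tendsto (fun n : ℕ => (n : ℝ) ^ 2 *
      ∫ u, (Real.exp (-(θ * u)) - 1 + θ * u) ∂(lawShiftDiv (p n) (c n))) atTop (𝓝 L) := by
  rcases hθ.eq_or_lt with rfl | hpos
  · exact ⟨0, by simp⟩
  have hc := tendsto_atTop_of_tendsto_div_sq hcpos hC2
  have ht : Tendsto (fun n => θ / c n) atTop (𝓝[≠] 0) :=
    tendsto_nhdsWithin_iff.2 ⟨hc.const_div_atTop θ,
      .of_forall fun n => (div_pos hpos (hcpos n)).ne'⟩
  have ht0 : Tendsto (fun n => θ / c n) atTop (𝓝 0) := tendsto_nhds_of_tendsto_nhdsWithin ht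
  have hexp : Tendsto (fun n => Real.exp (θ / c n)) atTop (𝓝 1) := by
    rw [← Real.exp_zero]
    exact (Real.continuous_exp.tendsto 0).comp ht0
  have hsq : Tendsto (fun n => c n ^ 2 * (Real.exp (θ / c n) - 1 - θ / c n)) atTop
      (𝓝 (θ ^ 2 * (1 / 2))) := by
    refine ((tendsto_exp_sub_one_sub_div_sq.comp ht).const_mul (θ ^ 2)).congr fun n => ?_
    have := hcpos n
    simp only [Function.comp_apply]
    field_simp
  have hl : Tendsto (fun n => c n * (1 - Real.exp (-(θ / c n)))) atTop (𝓝 θ) := by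
    have := (tendsto_one_sub_exp_neg_div.comp ht).const_mul θ
    rw [mul_one] at this
    refine this.congr fun n => ?_
    have := hcpos n
    simp only [Function.comp_apply]
    field_simp
  have hG : Tendsto (fun n => Gseq p c n (c n * (1 - Real.exp (-(θ / c n))))) atTop
      (𝓝 (G θ)) := by
    obtain ⟨K, hK⟩ := hGlip θ hpos
    have hdiff : Tendsto (fun n => Gseq p c n (c n * (1 - Real.exp (-(θ / c n))))
        - Gseq p c n θ) atTop (𝓝 0) := by
      have hb : Tendsto (fun n => K * |c n * (1 - Real.exp (-(θ / c n))) - θ|) atTop (𝓝 0) := by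
        simpa using ((hl.sub_const θ).abs).const_mul K
      refine squeeze_zero_norm' ?_ hb
      filter_upwards [hc.eventually_ge_atTop θ] with n hn
      have hcn := hcpos n
      have h1 : Real.exp (-(θ / c n)) ≤ 1 := Real.exp_le_one_iff.2 (by
        rw [neg_nonpos]; positivity)
      have h2 : 1 - θ / c n ≤ Real.exp (-(θ / c n)) := by
        linarith [Real.add_one_le_exp (-(θ / c n))]
      have h3 : c n * (1 - Real.exp (-(θ / c n))) ≤ θ := by
        calc c n * (1 - Real.exp (-(θ / c n))) ≤ c n * (θ / c n) := by
              gcongr; linarith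
          _ = θ := by field_simp
      exact hK n _ _ ⟨mul_nonneg hcn.le (by linarith), h3⟩ ⟨hθ, le_rfl⟩ (h3.trans hn) hn
    simpa using hdiff.add (hGlim θ hθ)
  refine ⟨_, ((hexp.mul hG).neg.sub (hD1.mul (hC2.mul hsq))).congr fun n => ?_⟩
  exact (sq_mul_integral_exp_sub_one_add p c n (hp0 n) (hp1 n) (hpm n) (hcpos n) hθ).symm

end Limits

section Weight

/-- The weight `(1 - e^{-u})²`, frozen to the left of `-1` so as to be bounded. -/
noncomputable def expWeight (u : ℝ) : ℝ := (1 - Real.exp (-max u (-1))) ^ 2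

theorem continuous_expWeight : Continuous expWeight := by
  unfold expWeight; fun_prop

theorem continuous_chi : Continuous chi := by
  unfold chi; fun_prop

theorem expWeight_nonneg (u : ℝ) : 0 ≤ expWeight u := sq_nonneg _

theorem expWeight_zero : expWeight 0 = 0 := by simp [expWeight]

theorem expWeight_of_ge {u : ℝ} (hu : -1 ≤ u) : expWeight u = (1 - Real.exp (-u)) ^ 2 := by
  rw [expWeight, max_eq_left hu]

theorem expWeight_le_one {u : ℝ} (hu : 0 ≤ u) : expWeight u ≤ 1 := by
  rw [expWeight_of_ge (by linarith)]
  have h1 := Real.exp_pos (-u)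
  have h2 : Real.exp (-u) ≤ 1 := Real.exp_le_one_iff.2 (by linarith)
  nlinarith

theorem expWeight_le_four (u : ℝ) : expWeight u ≤ 4 := by
  unfold expWeight
  have h1 := Real.exp_pos (-max u (-1))
  have h2 : Real.exp (-max u (-1)) ≤ 3 :=
    (Real.exp_le_exp.2 (neg_le.1 (le_max_right u (-1)))).trans
      (by simpa using Real.exp_one_lt_d9.le.trans (by norm_num))
  nlinarith

theorem abs_chi_le_one (u : ℝ) : |chi u| ≤ 1 :=
  abs_le.2 ⟨le_max_right _ _, max_le (min_le_left _ _) (by norm_num)⟩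

theorem chi_of_abs_le {u : ℝ} (hu : |u| ≤ 1) : chi u = u := by
  obtain ⟨h1, h2⟩ := abs_le.1 hu
  rw [chi, min_eq_right h2, max_eq_left h1]

theorem chi_of_one_le {u : ℝ} (hu : 1 ≤ u) : chi u = 1 := by
  rw [chi, min_eq_left hu, max_eq_left (by norm_num)]

theorem chi_of_le_neg_one {u : ℝ} (hu : u ≤ -1) : chi u = -1 := by
  rw [chi, min_eq_right (by linarith), max_eq_right hu]

theorem half_le_one_sub_exp_neg {u : ℝ} (h0 : 0 ≤ u) (h1 : u ≤ 1) :
    u / 2 ≤ 1 - Real.exp (-u) := by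
  have h := Real.add_one_le_exp u
  have h2 : Real.exp (-u) ≤ 1 / (u + 1) := by
    rw [Real.exp_neg, inv_eq_one_div]
    gcongr
  have h3 : 1 / (u + 1) ≤ 1 - u / 2 := by
    rw [div_le_iff₀ (by linarith)]
    nlinarith
  linarith

theorem half_le_one_sub_exp_neg_of_one_le {u : ℝ} (h1 : 1 ≤ u) :
    1 / 2 ≤ 1 - Real.exp (-u) := by
  have h := half_le_one_sub_exp_neg zero_le_one le_rfl
  have h2 : Real.exp (-u) ≤ Real.exp (-1) := Real.exp_le_exp.2 (by linarith)
  linarith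

theorem chi_sq_le (u : ℝ) : chi u ^ 2 ≤ 4 * expWeight u := by
  rcases le_total u (-1) with h | h
  · rw [chi_of_le_neg_one h, expWeight, max_eq_right h, neg_neg]
    nlinarith [Real.add_one_le_exp (1 : ℝ)]
  rw [expWeight_of_ge h]
  rcases le_total u 0 with h0 | h0
  · rw [chi_of_abs_le (abs_le.2 ⟨h, by linarith⟩)]
    nlinarith [Real.add_one_le_exp (-u)]
  rcases le_total u 1 with h1 | h1
  · rw [chi_of_abs_le (abs_le.2 ⟨h, h1⟩)]
    nlinarith [half_le_one_sub_exp_neg h0 h1]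
  · rw [chi_of_one_le h1]
    nlinarith [half_le_one_sub_exp_neg_of_one_le h1]

theorem expWeight_pos {u : ℝ} (hu : u ≠ 0) : 0 < expWeight u := by
  refine sq_pos_of_ne_zero fun h => ?_
  have h1 : -max u (-1) = 0 := Real.exp_eq_one_iff _ |>.1 (by linarith)
  rcases max_choice u (-1) with h2 | h2 <;> rw [h2] at h1
  · exact hu (neg_eq_zero.1 h1)
  · norm_num at h1

theorem min_le_expWeight {u : ℝ} (hu : 0 < u) :
    min u (u ^ 2) ≤ expWeight u * (4 * (1 + max (u - 1) 0)) := by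
  rw [expWeight_of_ge (by linarith)]
  rcases le_total u 1 with h1 | h1
  · refine (min_le_right _ _).trans ?_
    rw [max_eq_right (by linarith)]
    nlinarith [half_le_one_sub_exp_neg hu.le h1]
  · refine (min_le_left _ _).trans ?_
    rw [max_eq_left (by linarith)]
    have := half_le_one_sub_exp_neg_of_one_le h1
    nlinarith [mul_nonneg hu.le (show 0 ≤ (1 - Real.exp (-u)) ^ 2 - 1 / 4 by nlinarith)]

theorem tendsto_expWeight_div_sq :
    Tendsto (fun u => expWeight u / u ^ 2) (𝓝[≠] 0) (𝓝 1) := by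
  have h := tendsto_one_sub_exp_neg_div.pow 2
  rw [one_pow] at h
  refine h.congr' ?_
  filter_upwards [nhdsWithin_le_nhds (lt_mem_nhds (show (-1 : ℝ) < 0 by norm_num))] with u hu
  rw [expWeight_of_ge (le_of_lt hu), div_pow]

theorem abs_exp_sub_one_add_chi_le (u : ℝ) :
    |Real.exp (-max u (-1)) - 1 + chi u| ≤ chi u ^ 2 := by
  have key : ∀ v : ℝ, |v| ≤ 1 → |Real.exp (-v) - 1 + v| ≤ v ^ 2 := fun v hv => by
    have := Real.abs_exp_sub_one_sub_id_le (x := -v) (by rwa [abs_neg])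
    simpa using this
  rcases le_total u (-1) with h | h
  · rw [chi_of_le_neg_one h, max_eq_right h]
    exact key (-1) (by norm_num)
  rw [max_eq_left h]
  rcases le_total u 1 with h1 | h1
  · have h2 := abs_le.2 ⟨h, h1⟩
    rw [chi_of_abs_le h2]
    exact key u h2
  · rw [chi_of_one_le h1, sub_add_cancel, abs_of_pos (Real.exp_pos _), one_pow]
    exact Real.exp_le_one_iff.2 (by linarith)

end Weight

section WeightedLaw

/-- The finite measure with density `r * expWeight` with respect to `P`. -/
noncomputable def weightedLaw (r : ℝ) (P : Measure ℝ) : Measure ℝ :=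
  P.withDensity fun u => ENNReal.ofReal (r * expWeight u)

instance (r : ℝ) (P : Measure ℝ) [IsFiniteMeasure P] : IsFiniteMeasure (weightedLaw r P) := by
  refine isFiniteMeasure_withDensity_ofReal (Integrable.hasFiniteIntegral ?_)
  refine Integrable.const_mul (Integrable.of_bound (C := 4)
    continuous_expWeight.aestronglyMeasurable (.of_forall fun u => ?_)) r
  rw [Real.norm_of_nonneg (expWeight_nonneg u)]
  exact expWeight_le_four u

theorem integral_weightedLaw {r : ℝ} (hr : 0 ≤ r) (P : Measure ℝ) (g : ℝ → ℝ) :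
    ∫ u, g u ∂(weightedLaw r P) = r * ∫ u, expWeight u * g u ∂P := by
  rw [weightedLaw, integral_withDensity_eq_integral_toReal_smul
    (by have := continuous_expWeight.measurable; fun_prop) (by simp), ← integral_const_mul]
  refine integral_congr_ae (.of_forall fun u => ?_)
  simp only [ENNReal.toReal_ofReal (mul_nonneg hr (expWeight_nonneg u)), smul_eq_mul, mul_assoc]

/-- A bounded injective function that equals `e^{-u}` on `[-1, ∞)`. -/
noncomputable def expInj : ℝ →ᵇ ℝ :=
  BoundedContinuousFunction.ofNormedAddCommGroup
    (fun u => Real.exp (-max u (-1)) - Real.arctan (min (u + 1) 0)) (by fun_prop) 5 fun u => by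
      have h1 := Real.exp_pos (-max u (-1))
      have h2 : Real.exp (-max u (-1)) ≤ 3 :=
        (Real.exp_le_exp.2 (neg_le.1 (le_max_right u (-1)))).trans
          (by simpa using Real.exp_one_lt_d9.le.trans (by norm_num))
      have h3 := Real.arctan_lt_pi_div_two (min (u + 1) 0)
      have h4 := Real.neg_pi_div_two_lt_arctan (min (u + 1) 0)
      have h5 := Real.pi_lt_four
      rw [Real.norm_eq_abs, abs_le]
      constructor <;> linarith

theorem expInj_of_ge {u : ℝ} (hu : -1 ≤ u) : expInj u = Real.exp (-u) := by
  change Real.exp (-max u (-1)) - Real.arctan (min (u + 1) 0) = _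
  rw [max_eq_left hu, min_eq_right (by linarith), Real.arctan_zero, sub_zero]

theorem expInj_injective : Function.Injective expInj := by
  refine StrictAnti.injective fun u v huv => ?_
  change Real.exp (-max v (-1)) - Real.arctan (min (v + 1) 0)
    < Real.exp (-max u (-1)) - Real.arctan (min (u + 1) 0)
  rcases le_or_gt (-1) u with h | h
  · rw [max_eq_left h, max_eq_left (h.trans huv.le), min_eq_right (by linarith),
      min_eq_right (by linarith)]
    gcongr
  · have h1 : Real.exp (-max v (-1)) ≤ Real.exp (-max u (-1)) := by gcongr
    have h2 : Real.arctan (min (u + 1) 0) < Real.arctan (min (v + 1) 0) := by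
      refine Real.arctan_strictMono ?_
      rw [min_eq_left (show u + 1 ≤ 0 by linarith)]
      exact lt_min (by linarith) (by linarith)
    linarith

theorem integral_expInj_pow_weightedLaw {r : ℝ} (hr : 0 ≤ r) {P : Measure ℝ}
    [IsProbabilityMeasure P] (hid : Integrable (fun u => u) P)
    (hexp : ∀ θ : ℝ, 0 ≤ θ → Integrable (fun u => Real.exp (-(θ * u))) P)
    (hP : ∀ᵐ u ∂P, -1 ≤ u) (k : ℕ) :
    ∫ u, expInj u ^ k ∂(weightedLaw r P)
      = r * ∫ u, (Real.exp (-((k : ℕ) * u)) - 1 + (k : ℕ) * u) ∂P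
        - 2 * (r * ∫ u, (Real.exp (-((k + 1 : ℕ) * u)) - 1 + (k + 1 : ℕ) * u) ∂P)
        + r * ∫ u, (Real.exp (-((k + 2 : ℕ) * u)) - 1 + (k + 2 : ℕ) * u) ∂P := by
  have hi : ∀ j : ℕ, Integrable (fun u => Real.exp (-((j : ℕ) * u)) - 1 + (j : ℕ) * u) P :=
    fun j => ((hexp j j.cast_nonneg).sub (integrable_const _)).add (hid.const_mul _)
  have e : ∫ u, expWeight u * expInj u ^ k ∂P
      = ∫ u, ((Real.exp (-((k : ℕ) * u)) - 1 + (k : ℕ) * u)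
        - 2 * (Real.exp (-((k + 1 : ℕ) * u)) - 1 + (k + 1 : ℕ) * u)
        + (Real.exp (-((k + 2 : ℕ) * u)) - 1 + (k + 2 : ℕ) * u)) ∂P := by
    refine integral_congr_ae ?_
    filter_upwards [hP] with u hu
    rw [expWeight_of_ge hu, expInj_of_ge hu]
    have h : ∀ j : ℕ, Real.exp (-((j : ℕ) * u)) = Real.exp (-u) ^ j := fun j => by
      rw [← Real.exp_nat_mul]; congr 1; ring
    rw [h, h, h]
    push_cast
    ring
  have hi2 : Integrable (fun u => (Real.exp (-((k : ℕ) * u)) - 1 + (k : ℕ) * u)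
      - 2 * (Real.exp (-((k + 1 : ℕ) * u)) - 1 + (k + 1 : ℕ) * u)) P :=
    (hi k).sub ((hi (k + 1)).const_mul 2)
  rw [integral_weightedLaw hr, e, integral_add hi2 (hi (k + 2)),
    integral_sub (hi k) ((hi (k + 1)).const_mul 2), integral_const_mul]
  ring

theorem weightedLaw_compl_Icc_le {r : ℝ} (hr : 0 ≤ r) {P : Measure ℝ}
    (hint : Integrable (fun u => Real.exp (-u) - 1 + u) P)
    (hP : ∀ᵐ u ∂P, -1 ≤ u) (m : ℕ) :
    weightedLaw r P (Set.Icc (-1) (m + 2 : ℝ))ᶜ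
      ≤ ENNReal.ofReal ((r * ∫ u, (Real.exp (-u) - 1 + u) ∂P) / (m + 1)) := by
  have hpos : ∀ u : ℝ, 0 ≤ Real.exp (-u) - 1 + u := fun u => by
    linarith [Real.add_one_le_exp (-u)]
  have e : (r * ∫ u, (Real.exp (-u) - 1 + u) ∂P) / (m + 1)
      = ∫ u, r / (m + 1) * (Real.exp (-u) - 1 + u) ∂P := by
    rw [integral_const_mul]; ring
  rw [e, ofReal_integral_eq_lintegral_ofReal (hint.const_mul _)
    (.of_forall fun u => mul_nonneg (by positivity) (hpos u)), weightedLaw,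
    withDensity_apply _ measurableSet_Icc.compl, ← lintegral_indicator measurableSet_Icc.compl]
  refine lintegral_mono_ae ?_
  filter_upwards [hP] with u hu
  refine Set.indicator_apply_le' (fun hmem => ?_) (fun _ => zero_le)
  have hm : (m : ℝ) + 2 < u := by
    by_contra! hle
    exact hmem ⟨hu, hle⟩
  have hm0 : (0 : ℝ) ≤ m := m.cast_nonneg
  refine ENNReal.ofReal_le_ofReal ?_
  rw [div_mul_eq_mul_div, mul_div_assoc]
  refine mul_le_mul_of_nonneg_left ((expWeight_le_one (by linarith)).trans ?_) hr
  rw [le_div_iff₀ (by positivity)]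
  linarith [Real.exp_pos (-u)]

variable {P : ℕ → Measure ℝ} [∀ n, IsProbabilityMeasure (P n)] {r : ℕ → ℝ}

theorem exists_tendsto_integral_weightedLaw (hr : ∀ n, 0 ≤ r n)
    (hid : ∀ n, Integrable (fun u => u) (P n))
    (hexp : ∀ n (θ : ℝ), 0 ≤ θ → Integrable (fun u => Real.exp (-(θ * u))) (P n))
    (hP : ∀ᶠ n in atTop, ∀ᵐ u ∂(P n), -1 ≤ u)
    (hL : ∀ θ : ℝ, 0 ≤ θ →
      ∃ L, Tendsto (fun n => r n * ∫ u, (Real.exp (-(θ * u)) - 1 + θ * u) ∂(P n)) atTop (𝓝 L)) :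
    ∃ ν₀ : Measure ℝ, IsFiniteMeasure ν₀ ∧ ∀ g : ℝ →ᵇ ℝ,
      Tendsto (fun n => ∫ u, g u ∂(weightedLaw (r n) (P n))) atTop (𝓝 (∫ u, g u ∂ν₀)) := by
  let ν : ℕ → FiniteMeasure ℝ := fun n => ⟨weightedLaw (r n) (P n), inferInstance⟩
  have hmom : ∀ k : ℕ, ∃ L, Tendsto (fun n => ∫ u, expInj u ^ k ∂(weightedLaw (r n) (P n)))
      atTop (𝓝 L) := by
    intro k
    obtain ⟨L0, h0⟩ := hL (k : ℕ) (Nat.cast_nonneg _)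
    obtain ⟨L1, h1⟩ := hL (k + 1 : ℕ) (Nat.cast_nonneg _)
    obtain ⟨L2, h2⟩ := hL (k + 2 : ℕ) (Nat.cast_nonneg _)
    refine ⟨_, ((h0.sub (h1.const_mul 2)).add h2).congr' ?_⟩
    filter_upwards [hP] with n hn
    exact (integral_expInj_pow_weightedLaw (hr n) (hid n) (hexp n) hn k).symm
  obtain ⟨M, hM⟩ := hmom 0
  obtain ⟨L, hL1⟩ := hL 1 zero_le_one
  simp only [one_mul] at hL1
  have hu : Tendsto (fun m : ℕ => (L + 1).toNNReal / ((m : ℝ≥0) + 1)) atTop (𝓝 0) := by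
    rw [← NNReal.tendsto_coe]
    have h := (tendsto_one_div_add_atTop_nhds_zero_nat (𝕜 := ℝ)).const_mul
      ((L + 1).toNNReal : ℝ)
    rw [mul_zero] at h
    refine h.congr fun m => ?_
    push_cast
    ring
  have hev : ∀ᶠ n in atTop, (ν n).mass ≤ (M + 1).toNNReal ∧ ∀ m : ℕ,
      ν n (Set.Icc (-1) (m + 2 : ℝ))ᶜ ≤ (L + 1).toNNReal / ((m : ℝ≥0) + 1) := by
    filter_upwards [hP, hM.eventually_le_const (lt_add_one M),
      hL1.eventually_le_const (lt_add_one L)] with n hn hMn hLn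
    constructor
    · rw [← NNReal.coe_le_coe]
      refine le_trans ?_ (Real.le_coe_toNNReal _)
      simp only [pow_zero, integral_const, smul_eq_mul, mul_one] at hMn
      exact hMn
    · intro m
      rw [← ENNReal.coe_le_coe, FiniteMeasure.ennreal_coeFn_eq_coeFn_toMeasure]
      have hint : Integrable (fun u => Real.exp (-u) - 1 + u) (P n) := by
        have := hexp n 1 zero_le_one
        simp only [one_mul] at this
        exact (this.sub (integrable_const _)).add (hid n)
      refine (weightedLaw_compl_Icc_le (hr n) hint hn m).trans ?_
      have hm : (m : ℝ≥0) + 1 = ((m : ℝ) + 1).toNNReal := by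
        rw [Real.toNNReal_add (by positivity) zero_le_one]; simp
      rw [ENNReal.ofReal, ENNReal.coe_le_coe, hm, ← Real.toNNReal_div' (by positivity)]
      exact Real.toNNReal_le_toNNReal (by gcongr)
  have hK : Monotone fun m : ℕ => Set.Icc (-1) (m + 2 : ℝ) := fun m m' h =>
    Set.Icc_subset_Icc_right (add_le_add_left (Nat.cast_le.2 h) 2)
  obtain ⟨ν₀, hν₀⟩ := FiniteMeasure.exists_tendsto_of_tendsto_integral_pow
    _ hu (fun m => isCompact_Icc) hK hev expInj expInj_injective hmom
  exact ⟨ν₀, inferInstance, FiniteMeasure.tendsto_iff_forall_integral_tendsto.1 hν₀⟩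

end WeightedLaw

section LimitMeasure

/-- The restriction of `ν₀` to `(0, ∞)`, divided by `expWeight`. -/
noncomputable def unweightedPos (ν₀ : Measure ℝ) : Measure ℝ :=
  (ν₀.restrict (Set.Ioi 0)).withDensity fun u => ENNReal.ofReal (expWeight u)⁻¹

theorem measurable_inv_expWeight : Measurable fun u => (expWeight u)⁻¹ :=
  continuous_expWeight.measurable.inv

instance (ν₀ : Measure ℝ) [IsFiniteMeasure ν₀] : SigmaFinite (unweightedPos ν₀) :=
  SigmaFinite.withDensity_ofReal _

theorem unweightedPos_Iic (ν₀ : Measure ℝ) : unweightedPos ν₀ (Set.Iic 0) = 0 := by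
  refine withDensity_absolutelyContinuous _ _ ?_
  rw [Measure.restrict_apply measurableSet_Iic, Set.Iic_inter_Ioi, Set.Ioc_self, measure_empty]

theorem restrict_unweightedPos (ν₀ : Measure ℝ) :
    (unweightedPos ν₀).restrict (Set.Ioi 0) = unweightedPos ν₀ := by
  rw [unweightedPos, restrict_withDensity measurableSet_Ioi,
    Measure.restrict_restrict measurableSet_Ioi, Set.inter_self]

theorem setIntegral_unweightedPos (ν₀ : Measure ℝ) (h : ℝ → ℝ) :
    ∫ u in Set.Ioi 0, h u ∂(unweightedPos ν₀) = ∫ u in Set.Ioi 0, h u / expWeight u ∂ν₀ := by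
  rw [restrict_unweightedPos, unweightedPos, integral_withDensity_eq_integral_toReal_smul
    (by have := measurable_inv_expWeight; fun_prop) (by simp)]
  refine integral_congr_ae (.of_forall fun u => ?_)
  simp only [ENNReal.toReal_ofReal (inv_nonneg.2 (expWeight_nonneg u)), smul_eq_mul]
  rw [div_eq_inv_mul]

theorem setLIntegral_unweightedPos_lt_top (ν₀ : Measure ℝ) [IsFiniteMeasure ν₀]
    (h : ∫⁻ u, ENNReal.ofReal (max (u - 1) 0) ∂ν₀ < ⊤) :
    ∫⁻ u in Set.Ioi (0 : ℝ), ENNReal.ofReal (min u (u ^ 2)) ∂(unweightedPos ν₀) < ⊤ := by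
  rw [restrict_unweightedPos, unweightedPos, lintegral_withDensity_eq_lintegral_mul _
    (by have := measurable_inv_expWeight; fun_prop) (by fun_prop)]
  have hb : ∫⁻ u, 4 * (1 + ENNReal.ofReal (max (u - 1) 0)) ∂ν₀ < ⊤ := by
    rw [lintegral_const_mul _ (by fun_prop), lintegral_add_left measurable_const]
    refine ENNReal.mul_lt_top (by simp) (ENNReal.add_lt_top.2 ⟨?_, h⟩)
    simp
  refine lt_of_le_of_lt ?_ hb
  refine le_trans (setLIntegral_mono' measurableSet_Ioi fun u hu => ?_)
    (setLIntegral_le_lintegral _ _)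
  rw [Pi.mul_apply, ← ENNReal.ofReal_mul (inv_nonneg.2 (expWeight_nonneg u))]
  have e : 4 * (1 + ENNReal.ofReal (max (u - 1) 0))
      = ENNReal.ofReal (4 * (1 + max (u - 1) 0)) := by
    rw [ENNReal.ofReal_mul (by norm_num), ENNReal.ofReal_add zero_le_one (le_max_right _ _)]
    simp
  rw [e]
  refine ENNReal.ofReal_le_ofReal ?_
  have hu : 0 < u := hu
  rw [inv_mul_le_iff₀ (expWeight_pos hu.ne')]
  exact min_le_expWeight hu

theorem integral_eq_add_setIntegral_Ioi {ν₀ : Measure ℝ} (hν : ∀ᵐ u ∂ν₀, 0 ≤ u) {g : ℝ → ℝ}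
    (hg : Integrable g ν₀) :
    ∫ u, g u ∂ν₀ = g 0 * ν₀.real {0} + ∫ u in Set.Ioi 0, g u ∂ν₀ := by
  have h1 : ν₀.restrict (Set.Ici 0) = ν₀ := Measure.restrict_eq_self_of_ae_mem hν
  conv_lhs => rw [← h1]
  rw [← Set.Ioi_insert, Set.insert_eq, setIntegral_union (by simp) measurableSet_Ioi
    hg.integrableOn hg.integrableOn, integral_singleton, smul_eq_mul, mul_comm]

variable {P : ℕ → Measure ℝ} {r : ℕ → ℝ} {ν₀ : Measure ℝ} [IsFiniteMeasure ν₀]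

theorem ae_nonneg_of_tendsto (hP : ∀ ε > (0 : ℝ), ∀ᶠ n in atTop, ∀ᵐ u ∂(P n), -ε ≤ u)
    (hν₀ : ∀ g : ℝ →ᵇ ℝ,
      Tendsto (fun n => ∫ u, g u ∂(weightedLaw (r n) (P n))) atTop (𝓝 (∫ u, g u ∂ν₀))) :
    ∀ᵐ u ∂ν₀, 0 ≤ u := by
  have key : ∀ ε > (0 : ℝ), ∀ᵐ u ∂ν₀, -ε ≤ u := by
    intro ε hε
    let g : ℝ →ᵇ ℝ := BoundedContinuousFunction.ofNormedAddCommGroup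
      (fun u => min (max (-u - ε) 0) 1) (by fun_prop) 1 fun u => by
        rw [Real.norm_of_nonneg (le_min (le_max_right _ _) zero_le_one)]
        exact min_le_right _ _
    have hg : ∀ u, g u = min (max (-u - ε) 0) 1 := fun u => rfl
    have h0 : ∫ u, g u ∂ν₀ = 0 := by
      refine tendsto_nhds_unique (hν₀ g) (tendsto_const_nhds.congr' ?_)
      filter_upwards [hP ε hε] with n hn
      refine (integral_eq_zero_of_ae ?_).symm
      filter_upwards [withDensity_absolutelyContinuous (P n) _ |>.ae_le hn] with u hu
      rw [hg, max_eq_right (by linarith)]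
      simp
    have hg0 : 0 ≤ fun u => g u := fun u => le_min (le_max_right _ _) zero_le_one
    filter_upwards [(integral_eq_zero_iff_of_nonneg hg0 (g.integrable ν₀)).1 h0] with u hu
    by_contra! hlt
    rw [hg, Pi.zero_apply] at hu
    have : 0 < min (max (-u - ε) 0) 1 :=
      lt_min (lt_max_of_lt_left (by linarith)) zero_lt_one
    exact this.ne' hu
  have h := ae_all_iff.2 fun k : ℕ => key (1 / (k + 1)) (by positivity)
  filter_upwards [h] with u hu
  refine le_of_tendsto' (f := fun k : ℕ => -(1 / ((k : ℝ) + 1))) (x := atTop) ?_ hu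
  simpa using (tendsto_one_div_add_atTop_nhds_zero_nat (𝕜 := ℝ)).neg

theorem lintegral_sub_one_lt_top_of_tendsto (hr : ∀ n, 0 ≤ r n) [∀ n, IsFiniteMeasure (P n)]
    (hint : ∀ n, Integrable (fun u => Real.exp (-u) - 1 + u) (P n)) {L : ℝ}
    (hL : Tendsto (fun n => r n * ∫ u, (Real.exp (-u) - 1 + u) ∂(P n)) atTop (𝓝 L))
    (hν₀ : ∀ g : ℝ →ᵇ ℝ,
      Tendsto (fun n => ∫ u, g u ∂(weightedLaw (r n) (P n))) atTop (𝓝 (∫ u, g u ∂ν₀))) :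
    ∫⁻ u, ENNReal.ofReal (max (u - 1) 0) ∂ν₀ < ⊤ := by
  have hbound : ∀ M : ℕ, ∫⁻ u, ENNReal.ofReal (min (max (u - 1) 0) M) ∂ν₀ ≤ ENNReal.ofReal L := by
    intro M
    have hpos : ∀ u : ℝ, 0 ≤ min (max (u - 1) 0) (M : ℝ) := fun u =>
      le_min (le_max_right _ _) M.cast_nonneg
    let g : ℝ →ᵇ ℝ := BoundedContinuousFunction.ofNormedAddCommGroup
      (fun u => min (max (u - 1) 0) (M : ℝ)) (by fun_prop) M fun u => by
        rw [Real.norm_of_nonneg (hpos u)]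
        exact min_le_right _ _
    have hg : ∀ u, g u = min (max (u - 1) 0) (M : ℝ) := fun u => rfl
    have hle : ∫ u, g u ∂ν₀ ≤ L := by
      refine le_of_tendsto_of_tendsto' (hν₀ g) hL fun n => ?_
      rw [integral_weightedLaw (hr n)]
      refine mul_le_mul_of_nonneg_left (integral_mono_of_nonneg
        (.of_forall fun u => mul_nonneg (expWeight_nonneg u) (hpos u)) (hint n)
        (.of_forall fun u => ?_)) (hr n)
      change expWeight u * g u ≤ _
      rw [hg]
      rcases le_total u 1 with h | h
      · rw [max_eq_right (by linarith), min_eq_left M.cast_nonneg, mul_zero]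
        linarith [Real.add_one_le_exp (-u)]
      · rw [max_eq_left (by linarith)]
        calc expWeight u * min (u - 1) M ≤ 1 * (u - 1) :=
              mul_le_mul (expWeight_le_one (by linarith)) (min_le_left _ _)
                (le_min (by linarith) M.cast_nonneg) zero_le_one
          _ ≤ _ := by linarith [Real.exp_pos (-u)]
    refine le_trans (le_of_eq ?_) (ENNReal.ofReal_le_ofReal hle)
    exact (ofReal_integral_eq_lintegral_ofReal (g.integrable ν₀) (.of_forall hpos)).symm
  have hlim : Tendsto (fun M : ℕ => ∫⁻ u, ENNReal.ofReal (min (max (u - 1) 0) M) ∂ν₀) atTop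
      (𝓝 (∫⁻ u, ENNReal.ofReal (max (u - 1) 0) ∂ν₀)) := by
    refine lintegral_tendsto_of_tendsto_of_monotone (fun M => by fun_prop)
      (.of_forall fun u M M' h => ?_) (.of_forall fun u => ?_)
    · have h' : (M : ℝ) ≤ M' := Nat.cast_le.2 h
      exact ENNReal.ofReal_le_ofReal (min_le_min_left _ h')
    · refine tendsto_const_nhds.congr' ?_
      filter_upwards [(tendsto_natCast_atTop_atTop (R := ℝ)).eventually_ge_atTop
        (max (u - 1) 0)] with M hM
      rw [min_eq_left hM]
  exact (le_of_tendsto' hlim hbound).trans_lt ENNReal.ofReal_lt_top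

/-- Test functions that behave like `ℓ u²` at the origin and are dominated by `χ²`. -/
theorem tendsto_mul_integral_of_tendsto (hr : ∀ n, 0 ≤ r n) (hpos : ∀ᵐ u ∂ν₀, 0 ≤ u)
    (hν₀ : ∀ g : ℝ →ᵇ ℝ,
      Tendsto (fun n => ∫ u, g u ∂(weightedLaw (r n) (P n))) atTop (𝓝 (∫ u, g u ∂ν₀)))
    {h : ℝ → ℝ} (hc : Continuous h) {B ℓ : ℝ} (hB0 : 0 ≤ B) (hB : ∀ u, |h u| ≤ B * chi u ^ 2)
    (hℓ : Tendsto (fun u => h u / u ^ 2) (𝓝[≠] 0) (𝓝 ℓ)) :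
    Tendsto (fun n => r n * ∫ u, h u ∂(P n)) atTop
      (𝓝 (ℓ * ν₀.real {0} + ∫ u in Set.Ioi 0, h u ∂(unweightedPos ν₀))) := by
  have hlim : Tendsto (fun u => h u / expWeight u) (𝓝[≠] 0) (𝓝 ℓ) := by
    have := hℓ.div tendsto_expWeight_div_sq one_ne_zero
    rw [div_one] at this
    refine this.congr' ?_
    filter_upwards [self_mem_nhdsWithin] with u hu
    exact div_div_div_cancel_right₀ (pow_ne_zero 2 hu) _ _
  have hcont : Continuous (Function.update (fun u => h u / expWeight u) 0 ℓ) := by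
    refine continuous_iff_continuousAt.2 fun u => ?_
    rcases eq_or_ne u 0 with rfl | hu
    · exact continuousAt_update_same.2 hlim
    · rw [continuousAt_update_of_ne hu]
      exact hc.continuousAt.div continuous_expWeight.continuousAt (expWeight_pos hu).ne'
  let g : ℝ →ᵇ ℝ := BoundedContinuousFunction.ofNormedAddCommGroup _ hcont (max |ℓ| (4 * B))
    fun u => by
      rcases eq_or_ne u 0 with rfl | hu
      · simp
      · rw [Function.update_of_ne hu, Real.norm_eq_abs, abs_div, abs_of_pos (expWeight_pos hu),
          div_le_iff₀ (expWeight_pos hu)]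
        calc |h u| ≤ B * (4 * expWeight u) :=
              (hB u).trans (mul_le_mul_of_nonneg_left (chi_sq_le u) hB0)
          _ = 4 * B * expWeight u := by ring
          _ ≤ _ := mul_le_mul_of_nonneg_right (le_max_right _ _) (expWeight_nonneg u)
  have hgu : ∀ u, g u = Function.update (fun u => h u / expWeight u) 0 ℓ u := fun u => rfl
  have hg0 : g 0 = ℓ := by rw [hgu, Function.update_self]
  have hg : ∀ u ≠ 0, g u = h u / expWeight u := fun u hu => by
    rw [hgu, Function.update_of_ne hu]
  have hmul : ∀ u, expWeight u * g u = h u := by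
    intro u
    rcases eq_or_ne u 0 with rfl | hu
    · have := hB 0
      rw [chi_of_abs_le (by simp)] at this
      rw [expWeight_zero, zero_mul]
      exact (abs_nonpos_iff.1 (by simpa using this)).symm
    · rw [hg u hu, mul_div_cancel₀ _ (expWeight_pos hu).ne']
  have key := hν₀ g
  rw [integral_eq_add_setIntegral_Ioi hpos (g.integrable ν₀), hg0,
    setIntegral_congr_fun measurableSet_Ioi fun u (hu : 0 < u) => hg u hu.ne',
    ← setIntegral_unweightedPos] at key
  refine key.congr fun n => ?_
  rw [integral_weightedLaw (hr n)]
  simp only [hmul]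

end LimitMeasure

theorem exists_abs_le_mul_chi_sq {f : ℝ → ℝ} (hb : ∃ C, ∀ x : ℝ, |f x| ≤ C)
    (ho : f =o[𝓝 (0 : ℝ)] (fun x => x ^ 2)) : ∃ B, 0 ≤ B ∧ ∀ u, |f u| ≤ B * chi u ^ 2 := by
  obtain ⟨C, hC⟩ := hb
  have hC0 : 0 ≤ C := (abs_nonneg _).trans (hC 0)
  obtain ⟨δ, hδ, hball⟩ := Metric.eventually_nhds_iff.1 (ho.bound one_pos)
  set η := min δ 1 with hη
  have hη0 : 0 < η := lt_min hδ one_pos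
  refine ⟨max 1 (C / η ^ 2), le_max_of_le_left zero_le_one, fun u => ?_⟩
  rcases lt_or_ge |u| η with h | h
  · have h1 := hball (y := u) (by simpa using h.trans_le (min_le_left _ _))
    rw [chi_of_abs_le (h.le.trans (min_le_right _ _))]
    simp only [Real.norm_eq_abs, one_mul, abs_pow, sq_abs] at h1
    exact h1.trans (le_mul_of_one_le_left (sq_nonneg u) (le_max_left _ _))
  · have hchi : η ^ 2 ≤ chi u ^ 2 := by
      rcases le_total |u| 1 with h1 | h1
      · rw [chi_of_abs_le h1, ← sq_abs u]
        gcongr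
      · have : chi u ^ 2 = 1 := by
          rcases le_abs.1 h1 with h2 | h2
          · rw [chi_of_one_le h2, one_pow]
          · rw [chi_of_le_neg_one (by linarith)]; norm_num
        rw [this]
        exact pow_le_one₀ hη0.le (min_le_right _ _)
    calc |f u| ≤ C := hC u
      _ = C / η ^ 2 * η ^ 2 := by field_simp
      _ ≤ max 1 (C / η ^ 2) * chi u ^ 2 := by
        gcongr
        exact le_max_right _ _

theorem stmt5
    (p : ℕ → ℕ → ℝ)
    (hp0 : ∀ n i, 0 ≤ p n i) (hp1 : ∀ n, ∑' i, p n i = 1)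
    -- the offspring means `m_n` are finite
    (hpm : ∀ n, Summable fun i : ℕ => (i : ℝ) * p n i)
    (c : ℕ → ℝ) (hcpos : ∀ n, 0 < c n)
    (γ₀ a : ℝ) (hγ₀ : 0 ≤ γ₀)
    -- condition (C)
    (hC1 : Tendsto (fun n : ℕ => (n : ℝ) / c n) atTop atTop)
    (hC2 : Tendsto (fun n : ℕ => (n : ℝ) / c n ^ 2) atTop (𝓝 γ₀))
    -- condition (D1)
    (hD1 : Tendsto (fun n : ℕ => (n : ℝ) * (pgfMean (p n) - 1)) atTop (𝓝 a))
    -- condition (D2)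
    (G : ℝ → ℝ)
    (hGlip : ∀ M > (0 : ℝ), ∃ K : ℝ, ∀ (n : ℕ) (l l' : ℝ),
      l ∈ Set.Icc 0 M → l' ∈ Set.Icc 0 M → l ≤ c n → l' ≤ c n →
      |Gseq p c n l - Gseq p c n l'| ≤ K * |l - l'|)
    (hGlim : ∀ l : ℝ, 0 ≤ l → Tendsto (fun n => Gseq p c n l) atTop (𝓝 (G l)))
    (hGcont : ContinuousOn G (Set.Ici 0)) :
    ∃ (β₁ σ₁ : ℝ) (μm : Measure ℝ), 0 ≤ σ₁ ∧
      SigmaFinite μm ∧ μm (Set.Iic 0) = 0 ∧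
      (∫⁻ u in Set.Ioi (0 : ℝ), ENNReal.ofReal (min u (u ^ 2)) ∂μm) < ⊤ ∧
      -- (i)
      Tendsto (fun n : ℕ => (n : ℝ) ^ 2 * ∫ u, (chi u - u) ∂(lawShiftDiv (p n) (c n)))
        atTop (𝓝 β₁) ∧
      -- (ii)
      Tendsto (fun n : ℕ => (n : ℝ) ^ 2 * ∫ u, chi u ^ 2 ∂(lawShiftDiv (p n) (c n)))
        atTop (𝓝 (2 * σ₁ + ∫ u in Set.Ioi (0 : ℝ), chi u ^ 2 ∂μm)) ∧
      -- (iii)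
      (∀ f : ℝ → ℝ, Continuous f → (∃ C, ∀ x : ℝ, |f x| ≤ C) →
        f =o[𝓝 (0 : ℝ)] (fun x => x ^ 2) →
        Tendsto (fun n : ℕ => (n : ℝ) ^ 2 * ∫ u, f u ∂(lawShiftDiv (p n) (c n)))
          atTop (𝓝 (∫ u in Set.Ioi (0 : ℝ), f u ∂μm))) ∧
      -- `(n²/c_n) ∫ χ(u) μ_n(du) → a γ₀`
      Tendsto (fun n : ℕ => (n : ℝ) ^ 2 / c n * ∫ u, chi u ∂(lawShiftDiv (p n) (c n)))
        atTop (𝓝 (a * γ₀)) := by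
  have hctop := tendsto_atTop_of_tendsto_div_sq hcpos hC2
  have hprob : ∀ n, IsProbabilityMeasure (lawShiftDiv (p n) (c n)) := fun n =>
    isProbabilityMeasure_lawShiftDiv (hp0 n) (hp1 n)
  have hr : ∀ n : ℕ, 0 ≤ (n : ℝ) ^ 2 := fun n => by positivity
  have hid : ∀ n, Integrable (fun u => u) (lawShiftDiv (p n) (c n)) := fun n =>
    (integral_id_lawShiftDiv (hp0 n) (hp1 n) (hpm n)).1
  have hexp : ∀ n θ, 0 ≤ θ → Integrable (fun u => Real.exp (-(θ * u))) (lawShiftDiv (p n) (c n)) :=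
    fun n θ hθ => (integral_exp_lawShiftDiv (hp0 n) (hp1 n) (hcpos n) hθ).1
  have hP : ∀ ε > (0 : ℝ), ∀ᶠ n in atTop, ∀ᵐ u ∂(lawShiftDiv (p n) (c n)), -ε ≤ u := by
    intro ε hε
    filter_upwards [hctop.eventually_ge_atTop (1 / ε)] with n hn
    have h1 : 1 / c n ≤ ε := (one_div_le hε (hcpos n)).1 hn
    filter_upwards [ae_lawShiftDiv_ge (p := p n) (hcpos n)] with u hu
    linarith
  have hL := fun θ (hθ : 0 ≤ θ) =>
    exists_tendsto_sq_mul_integral_exp p hp0 hp1 hpm hcpos hC2 hD1 hGlip hGlim hθ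
  obtain ⟨ν₀, hfin, hν₀⟩ := exists_tendsto_integral_weightedLaw hr hid hexp (hP 1 one_pos) hL
  obtain ⟨L, hL1⟩ := hL 1 zero_le_one
  have hexp1 := fun n => hexp n 1 zero_le_one
  simp only [one_mul] at hL1 hexp1
  have hcomp : ∀ n, Integrable (fun u => Real.exp (-u) - 1 + u) (lawShiftDiv (p n) (c n)) :=
    fun n => ((hexp1 n).sub (integrable_const 1)).add (hid n)
  have hpos := ae_nonneg_of_tendsto hP hν₀
  have hmoment := lintegral_sub_one_lt_top_of_tendsto hr hcomp hL1 hν₀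
  have hchi : ∀ n, Integrable chi (lawShiftDiv (p n) (c n)) := fun n =>
    Integrable.of_bound continuous_chi.aestronglyMeasurable 1 (.of_forall abs_chi_le_one)
  have hnear : ∀ᶠ u : ℝ in 𝓝[≠] 0, |u| ≤ 1 ∧ u ≠ 0 := by
    refine Filter.Eventually.and (nhdsWithin_le_nhds ?_) self_mem_nhdsWithin
    filter_upwards [Metric.closedBall_mem_nhds (0 : ℝ) one_pos] with u hu
    simpa using hu
  have hi : ∃ β, Tendsto (fun n : ℕ => (n : ℝ) ^ 2 * ∫ u, (chi u - u) ∂(lawShiftDiv (p n) (c n)))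
      atTop (𝓝 β) := by
    have hcont : Continuous fun u => Real.exp (-max u (-1)) - 1 + chi u := by
      have := continuous_chi
      fun_prop
    have h3 := tendsto_mul_integral_of_tendsto hr hpos hν₀
      (h := fun u => Real.exp (-max u (-1)) - 1 + chi u) hcont
      zero_le_one (fun u => by simpa using abs_exp_sub_one_add_chi_le u)
      (tendsto_exp_neg_sub_one_add_div_sq.congr' (by
        filter_upwards [hnear] with u hu
        rw [chi_of_abs_le hu.1, max_eq_left (abs_le.1 hu.1).1]))
    refine ⟨_, (h3.sub hL1).congr' ?_⟩
    filter_upwards [hP 1 one_pos] with n hn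
    have hint : Integrable (fun u => Real.exp (-max u (-1)) - 1 + chi u)
        (lawShiftDiv (p n) (c n)) :=
      Integrable.of_bound hcont.aestronglyMeasurable 1 (.of_forall fun u =>
        (abs_exp_sub_one_add_chi_le u).trans ((sq_le_one_iff_abs_le_one _).2 (abs_chi_le_one u)))
    rw [← mul_sub, ← integral_sub hint (hcomp n)]
    congr 1
    refine integral_congr_ae ?_
    filter_upwards [hn] with u hu
    rw [max_eq_left hu]
    ring
  obtain ⟨β, hβ⟩ := hi
  refine ⟨β, ν₀.real {0} / 2, unweightedPos ν₀, by positivity, inferInstance,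
    unweightedPos_Iic ν₀, setLIntegral_unweightedPos_lt_top ν₀ hmoment, hβ, ?_, ?_, ?_⟩
  · have h2 := tendsto_mul_integral_of_tendsto hr hpos hν₀ (h := fun u => chi u ^ 2) (ℓ := 1)
      (continuous_chi.pow 2) zero_le_one (fun u => by simp)
      (tendsto_const_nhds.congr' (by
        filter_upwards [hnear] with u hu
        rw [chi_of_abs_le hu.1, div_self (pow_ne_zero 2 hu.2)]))
    rwa [one_mul, ← mul_div_cancel₀ (ν₀.real {0}) (two_ne_zero (α := ℝ))] at h2
  · intro f hf hfb hfo
    obtain ⟨B, hB0, hB⟩ := exists_abs_le_mul_chi_sq hfb hfo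
    simpa using tendsto_mul_integral_of_tendsto hr hpos hν₀ hf hB0 hB
      (hfo.tendsto_div_nhds_zero.mono_left nhdsWithin_le_nhds)
  · have h4 := ((tendsto_inv_atTop_zero.comp hctop).mul hβ).add (hD1.mul hC2)
    rw [zero_mul, zero_add] at h4
    refine h4.congr fun n => ?_
    rw [integral_sub (hchi n) (hid n), (integral_id_lawShiftDiv (hp0 n) (hp1 n) (hpm n)).2]
    have := (hcpos n).ne'
    simp only [Function.comp_apply]
    field_simp
    ring
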